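/- Let X be a Ptolemy space satisfying properties (E) and (I). Then X has the homothety property (H): for all distinct ω, ω' ∈ X, every Ptolemy circle σ through ω and ω', and any two points x, x' lying in the same connected component of σ∖{ω,ω'}, there exists a Möbius automorphism γ of X such that γ(ω)=ω, γ(ω')=ω', γ maps every Ptolemy circle through ω and ω' onto itself preserving each of its two arcs between ω and ω', and γ(x)=x'. -/

import Mathlib

open scoped ENNReal

namespace Mobius

/-- An extended metric on `X`, allowed to have (at most) one infinitely remote point,
which is recorded in the field `rem`.  Distances take values in `ℝ≥0∞`, and the value `⊤`
occurs exactly on pairs of distinct points one of which is the remote point. -/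
structure ExtMetric (X : Type*) where
  d : X → X → ℝ≥0∞
  rem : Option X
  symm : ∀ x y, d x y = d y x
  d_self : ∀ x, d x x = 0
  pos : ∀ x y, x ≠ y → 0 < d x y
  triangle : ∀ x y z, d x z ≤ d x y + d y z
  d_eq_top_iff : ∀ x y, d x y = ⊤ ↔ (x ≠ y ∧ (rem = some x ∨ rem = some y))

/-- The finite factor of a distance used in cross-ratio triples: infinite factors are
dropped (replaced by `1`), in accordance with the standard conventions for cross-ratio
triples of quadruples containing the infinitely remote point. -/
noncomputable def ExtMetric.fd {X : Type*} (d : ExtMetric X) (x y : X) : ℝ :=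
  if d.d x y = ⊤ then 1 else (d.d x y).toReal

/-- A representative in `ℝ³` of the cross-ratio triple
`crt(x,y,z,u) = (d(x,y)d(z,u) : d(x,z)d(y,u) : d(x,u)d(y,z)) ∈ ℝP²`,
with the standard conventions when the infinitely remote point occurs among the points. -/
noncomputable def crtVec {X : Type*} (d : ExtMetric X) (x y z u : X) : ℝ × ℝ × ℝ :=
  (d.fd x y * d.fd z u, d.fd x z * d.fd y u, d.fd x u * d.fd y z)

/-- A quadruple is admissible if no entry occurs three or four times in it. -/
def Admissible {X : Type*} (x y z u : X) : Prop :=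
  ¬(x = y ∧ y = z) ∧ ¬(x = y ∧ y = u) ∧ ¬(x = z ∧ z = u) ∧ ¬(y = z ∧ z = u)

/-- Two vectors in `ℝ³` represent the same point of the projective plane (they are
positively proportional). -/
def ProjEq (v w : ℝ × ℝ × ℝ) : Prop :=
  ∃ lam : ℝ, 0 < lam ∧ w = lam • v

theorem ProjEq.refl (v : ℝ × ℝ × ℝ) : ProjEq v v :=
  ⟨1, one_pos, (one_smul ℝ v).symm⟩

theorem ProjEq.symm {v w : ℝ × ℝ × ℝ} (h : ProjEq v w) : ProjEq w v := by
  obtain ⟨l, hl, rfl⟩ := h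
  exact ⟨l⁻¹, inv_pos.mpr hl, by rw [smul_smul, inv_mul_cancel₀ hl.ne', one_smul]⟩

theorem ProjEq.trans' {v w u : ℝ × ℝ × ℝ} (h1 : ProjEq v w) (h2 : ProjEq v u) :
    ProjEq w u := by
  obtain ⟨l, hl, rfl⟩ := h1
  obtain ⟨m, hm, rfl⟩ := h2
  refine ⟨m * l⁻¹, by positivity, ?_⟩
  rw [smul_smul, mul_assoc, inv_mul_cancel₀ hl.ne', mul_one]

/-- A Möbius structure on a set `X`: a (maximal) class of pairwise Möbius-equivalent
extended metrics on `X`, i.e. metrics defining the same cross-ratio triples on all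
admissible quadruples. -/
structure MobiusStructure (X : Type*) where
  M : Set (ExtMetric X)
  nonempty : M.Nonempty
  compat : ∀ d ∈ M, ∀ d' ∈ M, ∀ x y z u : X, Admissible x y z u →
    ProjEq (crtVec d x y z u) (crtVec d' x y z u)
  maximal : ∀ d' : ExtMetric X,
    (∀ d ∈ M, ∀ x y z u : X, Admissible x y z u →
      ProjEq (crtVec d x y z u) (crtVec d' x y z u)) → d' ∈ M

/-- The Möbius structure generated by a single extended metric. -/
def MobiusStructure.ofMetric {X : Type*} (d₀ : ExtMetric X) : MobiusStructure X where
  M := {d | ∀ x y z u : X, Admissible x y z u →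
    ProjEq (crtVec d₀ x y z u) (crtVec d x y z u)}
  nonempty := ⟨d₀, fun _ _ _ _ _ => ProjEq.refl _⟩
  compat := fun _ hd _ hd' x y z u ha => (hd x y z u ha).trans' (hd' x y z u ha)
  maximal := fun _ h => h d₀ (fun _ _ _ _ _ => ProjEq.refl _)

/-- A Möbius structure is Ptolemy if the entries of every cross-ratio triple of every
admissible quadruple satisfy the triangle inequality. -/
def IsPtolemyStructure {X : Type*} (S : MobiusStructure X) : Prop :=
  ∀ d ∈ S.M, ∀ x y z u : X, Admissible x y z u →
    (crtVec d x y z u).1 ≤ (crtVec d x y z u).2.1 + (crtVec d x y z u).2.2 ∧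
    (crtVec d x y z u).2.1 ≤ (crtVec d x y z u).1 + (crtVec d x y z u).2.2 ∧
    (crtVec d x y z u).2.2 ≤ (crtVec d x y z u).1 + (crtVec d x y z u).2.1

/-- The topology of a Möbius space: generated by the open balls of the metrics of the
structure (centered at points distinct from the respective remote points) together with
the complements of the closed balls. -/
def mobiusTop {X : Type*} (S : MobiusStructure X) : TopologicalSpace X :=
  TopologicalSpace.generateFrom
    {s | ∃ d ∈ S.M, ∃ x : X, d.rem ≠ some x ∧ ∃ r : ℝ≥0∞, 0 < r ∧ r ≠ ⊤ ∧
      (s = {y | d.d y x < r} ∨ s = {y | r < d.d y x})}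

/-- Connected components of subsets with respect to the Möbius topology. -/
def mobiusCCIn {X : Type*} (S : MobiusStructure X) (F : Set X) (x : X) : Set X :=
  @connectedComponentIn X (mobiusTop S) F x

/-- The pair `(x,z)` separates the pair `(y,u)` in `σ`:  `y` and `u` lie in different
connected components of `σ \ {x,z}`. -/
def SeparatesIn {X : Type*} (S : MobiusStructure X) (σ : Set X) (x z y u : X) : Prop :=
  u ∉ mobiusCCIn S (σ \ {x, z}) y

/-- `σ` is homeomorphic to the circle `S¹` (with respect to the Möbius topology). -/
def HomeoToCircle {X : Type*} (S : MobiusStructure X) (σ : Set X) : Prop :=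
  letI : TopologicalSpace X := mobiusTop S
  Nonempty (σ ≃ₜ Metric.sphere (0 : ℂ) 1)

/-- `X` is homeomorphic to the sphere `Sⁿ ⊆ ℝ^{n+1}` (w.r.t. the Möbius topology). -/
def HomeoToSphere {X : Type*} (S : MobiusStructure X) (n : ℕ) : Prop :=
  letI : TopologicalSpace X := mobiusTop S
  Nonempty (X ≃ₜ Metric.sphere (0 : EuclideanSpace ℝ (Fin (n + 1))) 1)

/-- The subset `A ⊆ X` is homeomorphic to `ℝᵖ` (w.r.t. the Möbius topology). -/
def SubsetHomeoToEuclidean {X : Type*} (S : MobiusStructure X) (A : Set X) (p : ℕ) : Prop :=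
  letI : TopologicalSpace X := mobiusTop S
  Nonempty (A ≃ₜ EuclideanSpace ℝ (Fin p))

/-- The subset `A ⊆ X` is homeomorphic to `ℝ` (w.r.t. the Möbius topology). -/
def SubsetHomeoToReal {X : Type*} (S : MobiusStructure X) (A : Set X) : Prop :=
  letI : TopologicalSpace X := mobiusTop S
  Nonempty (A ≃ₜ ℝ)

/-- A Ptolemy circle: a subset homeomorphic to `S¹` on which the Ptolemy equality holds
for every quadruple of distinct points `(x,y,z,u)` such that `(x,z)` separates `(y,u)`. -/
def IsPtolemyCircle {X : Type*} (S : MobiusStructure X) (σ : Set X) : Prop :=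
  HomeoToCircle S σ ∧
  ∀ d ∈ S.M, ∀ x ∈ σ, ∀ y ∈ σ, ∀ z ∈ σ, ∀ u ∈ σ,
    x ≠ y → x ≠ z → x ≠ u → y ≠ z → y ≠ u → z ≠ u →
    SeparatesIn S σ x z y u →
    d.d x z * d.d y u = d.d x y * d.d z u + d.d x u * d.d y z

/-- A Möbius automorphism of `X`: a bijection preserving all cross-ratio triples. -/
def IsMobiusAuto {X : Type*} (S : MobiusStructure X) (f : X → X) : Prop :=
  Function.Bijective f ∧ ∀ d ∈ S.M, ∀ x y z u : X, Admissible x y z u →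
    ProjEq (crtVec d x y z u) (crtVec d (f x) (f y) (f z) (f u))

/-- A metric sphere between two distinct points `ω`, `ω'`. -/
def IsMetricSphere {X : Type*} (S : MobiusStructure X) (ω ω' : X) (Sp : Set X) : Prop :=
  ∃ d ∈ S.M, d.rem = some ω' ∧ ∃ r : ℝ≥0∞, 0 < r ∧ r ≠ ⊤ ∧ Sp = {x | d.d x ω = r}

/-- A space inversion with respect to `ω`, `ω'` and a metric sphere `Sp` between them. -/
def IsSpaceInversion {X : Type*} (S : MobiusStructure X) (ω ω' : X) (Sp : Set X)
    (φ : X → X) : Prop :=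
  IsMobiusAuto S φ ∧ Function.Involutive φ ∧ (∀ x, φ x ≠ x) ∧ φ ω = ω' ∧
  φ '' Sp = Sp ∧ ∀ σ : Set X, IsPtolemyCircle S σ → ω ∈ σ → ω' ∈ σ → φ '' σ = σ

/-- Property (E): existence of at least one Ptolemy circle. -/
def PropertyE {X : Type*} (S : MobiusStructure X) : Prop :=
  ∃ σ : Set X, IsPtolemyCircle S σ

/-- Property (I): existence and uniqueness of space inversions. -/
def PropertyI {X : Type*} (S : MobiusStructure X) : Prop :=
  ∀ ω ω' : X, ω ≠ ω' → ∀ Sp : Set X, IsMetricSphere S ω ω' Sp →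
    ∃! φ : X → X, IsSpaceInversion S ω ω' Sp φ

/-- The Möbius space is compact. -/
def MobiusCompact {X : Type*} (S : MobiusStructure X) : Prop :=
  letI : TopologicalSpace X := mobiusTop S
  CompactSpace X

/-- Property (H), the homothety property. -/
def PropertyH {X : Type*} (S : MobiusStructure X) : Prop :=
  ∀ ω ω' : X, ω ≠ ω' → ∀ σ : Set X, IsPtolemyCircle S σ → ω ∈ σ → ω' ∈ σ →
    ∀ x x' : X, x ∈ σ \ {ω, ω'} → x' ∈ mobiusCCIn S (σ \ {ω, ω'}) x →
    ∃ γ : X → X, IsMobiusAuto S γ ∧ γ ω = ω ∧ γ ω' = ω' ∧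
      (∀ σ' : Set X, IsPtolemyCircle S σ' → ω ∈ σ' → ω' ∈ σ' →
        γ '' σ' = σ' ∧ ∀ y ∈ σ' \ {ω, ω'}, γ y ∈ mobiusCCIn S (σ' \ {ω, ω'}) y) ∧
      γ x = x'

/-- A Ptolemy line in `X_ω`: a Ptolemy circle through `ω` with `ω` removed. -/
def IsPtolemyLine {X : Type*} (S : MobiusStructure X) (ω : X) (l : Set X) : Prop :=
  ∃ σ : Set X, IsPtolemyCircle S σ ∧ ω ∈ σ ∧ l = σ \ {ω}

/-- `c : ℝ → X` is a unit-speed parameterization of `l ⊆ X` w.r.t. the metric `d`. -/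
def IsUnitSpeed {X : Type*} (d : ExtMetric X) (l : Set X) (c : ℝ → X) : Prop :=
  Set.range c = l ∧ ∀ s t : ℝ, d.d (c s) (c t) = ENNReal.ofReal |s - t|

/-- `b` is a Busemann function of the Ptolemy line `l ⊆ X_ω`:  up to an additive constant,
`b x = lim_{t→∞} (d(x,c(t)) − t)` for a unit-speed parameterization `c` of `l`. -/
def IsBusemannOf {X : Type*} (S : MobiusStructure X) (d : ExtMetric X) (ω : X)
    (l : Set X) (b : X → ℝ) : Prop :=
  IsPtolemyLine S ω l ∧ ∃ c : ℝ → X, IsUnitSpeed d l c ∧ ∃ C : ℝ, ∀ x : X, x ≠ ω →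
    Filter.Tendsto (fun t => (d.d x (c t)).toReal - t) Filter.atTop (nhds (b x + C))

/-- The fiber through `x` of the canonical fibration `π_ω`: the set of points on which
every Busemann function of every Ptolemy line of `X_ω` takes the same value as at `x`. -/
def mobiusFiber {X : Type*} (S : MobiusStructure X) (d : ExtMetric X) (ω : X) (x : X) :
    Set X :=
  {y | y ≠ ω ∧ ∀ (l : Set X) (b : X → ℝ), IsBusemannOf S d ω l b → b y = b x}

/-- The base `B_ω` of the canonical fibration: the set of all fibers. -/
def mobiusBase {X : Type*} (S : MobiusStructure X) (d : ExtMetric X) (ω : X) :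
    Set (Set X) :=
  {F | ∃ x : X, x ≠ ω ∧ F = mobiusFiber S d ω x}

/-- The distance between two fibers. -/
noncomputable def fiberDist {X : Type*} (d : ExtMetric X) (F F' : Set X) : ℝ :=
  sInf {r : ℝ | ∃ x ∈ F, ∃ x' ∈ F', r = (d.d x x').toReal}

/-- Two Möbius spaces are Möbius equivalent: there is a bijection between them
preserving all cross-ratio triples. -/
def MobiusEquiv {X Y : Type*} (S : MobiusStructure X) (S' : MobiusStructure Y) : Prop :=
  ∃ f : X → Y, Function.Bijective f ∧ ∀ d ∈ S.M, ∀ d' ∈ S'.M, ∀ x y z u : X,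
    Admissible x y z u → ProjEq (crtVec d x y z u) (crtVec d' (f x) (f y) (f z) (f u))

/-- The standard extended Euclidean metric on the one-point extension
`ℝ̂ⁿ = ℝⁿ ∪ {∞}`, where `∞` is encoded by `none`. -/
noncomputable def stdExtMetric (n : ℕ) : ExtMetric (Option (EuclideanSpace ℝ (Fin n))) where
  d x y :=
    match x, y with
    | none, none => 0
    | none, some _ => ⊤
    | some _, none => ⊤
    | some a, some b => ENNReal.ofReal (dist a b)
  rem := some none
  symm := by intro x y; cases x <;> cases y <;> simp [dist_comm]
  d_self := by intro x; cases x <;> simp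
  pos := by
    intro x y h
    cases x <;> cases y
    · exact absurd rfl h
    · simp
    · simp
    · simp only [ne_eq, Option.some.injEq] at h
      exact ENNReal.ofReal_pos.mpr (dist_pos.mpr h)
  triangle := by
    intro x y z
    cases x <;> cases y <;> cases z <;>
      simp only [le_refl, le_top, zero_le, zero_add, add_zero, top_add, add_top,
        top_le_iff]
    rw [← ENNReal.ofReal_add dist_nonneg dist_nonneg]
    exact ENNReal.ofReal_le_ofReal (dist_triangle _ _ _)
  d_eq_top_iff := by
    intro x y
    cases x <;> cases y <;>
      simp [ENNReal.ofReal_ne_top]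


theorem sdiff_pair_subset {X : Type*} (σ : Set X) (w p : X) : σ \ {w, p} ⊆ σ \ {w} :=
  Set.sdiff_subset_sdiff_right (by simp)

section Topology

variable {X : Type*} [TopologicalSpace X]

/-- A chart of `σ \ {w}` by the real line, with inverse `f`. -/
structure IsLineChart (σ : Set X) (w : X) (e : X → ℝ) (f : ℝ → X) : Prop where
  continuousOn : ContinuousOn e (σ \ {w})
  continuous_inv : Continuous f
  mem : ∀ t, f t ∈ σ \ {w}
  right_inv : ∀ t, e (f t) = t
  left_inv : ∀ x ∈ σ \ {w}, f (e x) = x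

theorem exists_isLineChart {σ : Set X} (h : Nonempty (σ ≃ₜ Metric.sphere (0 : ℂ) 1)) {w : X}
    (hw : w ∈ σ) : ∃ e f, IsLineChart σ w e f := by
  classical
  obtain ⟨h⟩ := h
  have : Fact (Module.finrank ℝ ℂ = 1 + 1) := ⟨Complex.finrank_real_complex⟩
  let k : OpenPartialHomeomorph (Metric.sphere (0 : ℂ) 1) (EuclideanSpace ℝ (Fin 1)) :=
    stereographic' 1 (h ⟨w, hw⟩)
  have hks : k.source = {h ⟨w, hw⟩}ᶜ := stereographic'_source _
  have hkt : k.target = Set.univ := stereographic'_target _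
  let c : EuclideanSpace ℝ (Fin 1) ≃ₜ ℝ :=
    (PiLp.homeomorph 2 (fun _ : Fin 1 => ℝ)).trans (Homeomorph.funUnique (Fin 1) ℝ)
  have hsrc : ∀ (x : X) (hx : x ∈ σ), x ≠ w → h ⟨x, hx⟩ ∈ k.source := by
    intro x hx hxw
    simp [hks, hxw]
  refine ⟨fun x => if hx : x ∈ σ then c (k (h ⟨x, hx⟩)) else 0,
    fun t => h.symm (k.symm (c.symm t)), ?_, ?_, ?_, ?_, ?_⟩
  · rw [continuousOn_iff_continuous_domRestrict]
    have hr : (σ \ {w}).domRestrict (fun x => if hx : x ∈ σ then c (k (h ⟨x, hx⟩)) else 0) =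
        fun x : (σ \ {w} : Set X) => c (k (h ⟨x, x.2.1⟩)) := by
      funext x
      simp [Set.domRestrict_apply, x.2.1]
    rw [hr]
    refine c.continuous.comp (k.continuousOn.comp_continuous (by fun_prop) ?_)
    intro x
    exact hsrc x x.2.1 x.2.2
  · refine continuous_subtype_val.comp (h.symm.continuous.comp ?_)
    refine k.continuousOn_symm.comp_continuous c.symm.continuous ?_
    intro t
    simp [hkt]
  · intro t
    refine ⟨Subtype.coe_prop _, ?_⟩
    intro ht
    have h1 : k.symm (c.symm t) ∈ k.source := k.map_target (by simp [hkt])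
    have h2 : h.symm (k.symm (c.symm t)) = ⟨w, hw⟩ := Subtype.ext ht
    rw [hks, Homeomorph.symm_apply_eq] at *
    exact h1 h2
  · intro t
    simp only [Subtype.coe_prop, dite_true, Subtype.coe_eta, Homeomorph.apply_symm_apply]
    rw [k.right_inv (by simp [hkt]), Homeomorph.apply_symm_apply]
  · rintro x ⟨hx, hxw⟩
    simp only [hx, dite_true, Homeomorph.symm_apply_apply]
    rw [k.left_inv (hsrc x hx hxw), Homeomorph.symm_apply_apply]

namespace IsLineChart

variable {σ : Set X} {w : X} {e : X → ℝ} {f : ℝ → X}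

theorem injOn (hc : IsLineChart σ w e f) : Set.InjOn e (σ \ {w}) := fun x hx y hy h => by
  rw [← hc.left_inv x hx, h, hc.left_inv y hy]

theorem infinite (hc : IsLineChart σ w e f) : σ.Infinite :=
  (Set.infinite_range_of_injective (Function.LeftInverse.injective hc.right_inv)).mono
    (Set.range_subset_iff.mpr fun t => (hc.mem t).1)

theorem ne_of_mem (hc : IsLineChart σ w e f) {p u : X} (hp : p ∈ σ \ {w})
    (hu : u ∈ σ \ {w, p}) : e u ≠ e p := fun h => by
  have := hc.injOn (sdiff_pair_subset _ _ _ hu) hp h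
  exact hu.2 (by simp [this])

/-- The two components of `σ \ {w, p}` are the two sides of `p` in a chart at `w`. -/
theorem mem_connectedComponentIn_iff (hc : IsLineChart σ w e f) {p u v : X}
    (hp : p ∈ σ \ {w}) (hu : u ∈ σ \ {w, p}) (hv : v ∈ σ \ {w, p}) :
    v ∈ connectedComponentIn (σ \ {w, p}) u ↔ (e u < e p ↔ e v < e p) := by
  have hsub := connectedComponentIn_subset (σ \ {w, p}) u
  constructor
  · intro hvC
    have huC := mem_connectedComponentIn hu
    have hpre : IsPreconnected (e '' connectedComponentIn (σ \ {w, p}) u) :=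
      isPreconnected_connectedComponentIn.image _
        (hc.continuousOn.mono (hsub.trans (sdiff_pair_subset _ _ _)))
    have hno : e p ∉ e '' connectedComponentIn (σ \ {w, p}) u := by
      rintro ⟨c, hcC, h⟩
      exact hc.ne_of_mem hp (hsub hcC) h
    have hoc := hpre.ordConnected
    constructor
    · intro h
      by_contra h'
      exact hno (hoc.out ⟨u, huC, rfl⟩ ⟨v, hvC, rfl⟩ ⟨h.le, not_lt.mp h'⟩)
    · intro h
      by_contra h'
      exact hno (hoc.out ⟨v, hvC, rfl⟩ ⟨u, huC, rfl⟩ ⟨h.le, not_lt.mp h'⟩)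
  · intro h
    have key : ∀ s : Set ℝ, IsPreconnected s → e u ∈ s → e v ∈ s → e p ∉ s →
        v ∈ connectedComponentIn (σ \ {w, p}) u := by
      intro s hs hus hvs hps
      have hsub' : f '' s ⊆ σ \ {w, p} := by
        rintro _ ⟨t, ht, rfl⟩
        refine ⟨(hc.mem t).1, ?_⟩
        rintro (h | h)
        · exact (hc.mem t).2 h
        · apply hps
          have : f t = p := h
          rw [← this, hc.right_inv]
          exact ht
      refine (hs.image f hc.continuous_inv.continuousOn).subset_connectedComponentIn
        ⟨e u, hus, hc.left_inv u (sdiff_pair_subset _ _ _ hu)⟩ hsub'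
        ⟨e v, hvs, hc.left_inv v (sdiff_pair_subset _ _ _ hv)⟩
    rcases lt_or_gt_of_ne (hc.ne_of_mem hp hu) with hlt | hgt
    · exact key (Set.Iio (e p)) isPreconnected_Iio hlt (h.mp hlt) (by simp)
    · refine key (Set.Ioi (e p)) isPreconnected_Ioi hgt ?_ (by simp)
      exact lt_of_le_of_ne (not_lt.mp (fun h' => hgt.not_gt (h.mpr h')))
        (hc.ne_of_mem hp hv).symm

/-- A fixed-point-free continuous involution of `σ` preserving `{w, p}` swaps the two
components of `σ \ {w, p}`. -/
theorem notMem_connectedComponentIn_of_involutive (hc : IsLineChart σ w e f) {p : X}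
    {φ : X → X} (hφ : Continuous φ) (hinv : Function.Involutive φ) (hfix : ∀ x, φ x ≠ x)
    (hmaps : Set.MapsTo φ (σ \ {w, p}) (σ \ {w, p})) {y : X} (hy : y ∈ σ \ {w, p}) :
    φ y ∉ connectedComponentIn (σ \ {w, p}) y := by
  intro hmem
  have hsub := connectedComponentIn_subset (σ \ {w, p}) y
  have hself : Set.MapsTo φ (connectedComponentIn (σ \ {w, p}) y)
      (connectedComponentIn (σ \ {w, p}) y) := by
    rw [Set.mapsTo_iff_image_subset]
    conv_rhs => rw [connectedComponentIn_eq hmem]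
    exact (isPreconnected_connectedComponentIn.image _
      hφ.continuousOn).subset_connectedComponentIn
      ⟨y, mem_connectedComponentIn hy, rfl⟩ ((hmaps.mono_left hsub).image_subset)
  have he := hc.continuousOn.mono (hsub.trans (sdiff_pair_subset _ _ _))
  have heφ : ContinuousOn (e ∘ φ) (connectedComponentIn (σ \ {w, p}) y) :=
    he.comp hφ.continuousOn hself
  have hyC := mem_connectedComponentIn hy
  have hex : ∃ x ∈ connectedComponentIn (σ \ {w, p}) y, e x = (e ∘ φ) x := by
    rcases le_total (e y) (e (φ y)) with h | h
    · exact isPreconnected_connectedComponentIn.intermediate_value₂ hyC hmem he heφ h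
        (by simpa [hinv y] using h)
    · exact isPreconnected_connectedComponentIn.intermediate_value₂ hmem hyC he heφ
        (by simpa [hinv y] using h) h
  obtain ⟨x, hx, hxe⟩ := hex
  exact hfix x (hc.injOn (sdiff_pair_subset _ _ _ (hsub (hself hx)))
    (sdiff_pair_subset _ _ _ (hsub hx)) hxe.symm)

end IsLineChart

theorem isPreconnected_of_homeomorph_circle {σ : Set X}
    (h : Nonempty (σ ≃ₜ Metric.sphere (0 : ℂ) 1)) : IsPreconnected σ := by
  obtain ⟨h⟩ := h
  have hs : IsPreconnected (Metric.sphere (0 : ℂ) 1) :=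
    isPreconnected_sphere (by rw [Complex.rank_real_complex]; norm_num) 0 1
  have : PreconnectedSpace (Metric.sphere (0 : ℂ) 1) := Subtype.preconnectedSpace hs
  rw [isPreconnected_iff_preconnectedSpace]
  exact h.symm.surjective.denseRange.preconnectedSpace h.symm.continuous

end Topology

namespace ExtMetric

variable {X : Type*} (d : ExtMetric X)

theorem fd_self (x : X) : d.fd x x = 0 := by simp [fd, d.d_self]

theorem fd_symm (x y : X) : d.fd x y = d.fd y x := by simp [fd, d.symm x y]

theorem fd_pos {x y : X} (h : x ≠ y) : 0 < d.fd x y := by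
  unfold fd
  split_ifs with h'
  · exact one_pos
  · exact ENNReal.toReal_pos (d.pos x y h).ne' h'

variable {d}

theorem fd_rem {w x : X} (hd : d.rem = some w) (h : x ≠ w) : d.fd x w = 1 := by
  have : d.d x w = ⊤ := (d.d_eq_top_iff x w).mpr ⟨h, Or.inr hd⟩
  simp [fd, this]

theorem d_eq_ofReal_fd {x y : X} (h : d.d x y ≠ ⊤) : d.d x y = ENNReal.ofReal (d.fd x y) := by
  simp [fd, h]

theorem d_ne_top {w x y : X} (hd : d.rem = some w) (hx : x ≠ w) (hy : y ≠ w) :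
    d.d x y ≠ ⊤ := fun h => by
  have := ((d.d_eq_top_iff x y).mp h).2
  simp only [hd, Option.some.injEq] at this
  tauto

/-- The pullback of an extended metric by a bijection. -/
noncomputable def pullback (d : ExtMetric X) (e : X ≃ X) : ExtMetric X where
  d x y := d.d (e x) (e y)
  rem := d.rem.map e.symm
  symm x y := d.symm _ _
  d_self x := d.d_self _
  pos x y h := d.pos _ _ (e.injective.ne h)
  triangle x y z := d.triangle _ _ _
  d_eq_top_iff x y := by
    rw [d.d_eq_top_iff]
    have (z : X) : d.rem.map e.symm = some z ↔ d.rem = some (e z) := by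
      simp [Option.map_eq_some_iff, Equiv.symm_apply_eq]
    rw [this, this, e.injective.ne_iff]

open Classical in
/-- The metric inversion of an extended metric with the Ptolemy property, which sends the
point `w` to infinity. -/
noncomputable def invert (d : ExtMetric X) (w : X)
    (hd : ∀ x y z, x ≠ w → y ≠ w → z ≠ w →
      d.fd x z * d.fd y w ≤ d.fd x y * d.fd z w + d.fd x w * d.fd y z) : ExtMetric X where
  d x y := if x = y then 0 else if x = w ∨ y = w then ⊤ else
    ENNReal.ofReal (d.fd x y / (d.fd x w * d.fd y w))
  rem := some w
  symm x y := by
    simp only [eq_comm (a := x) (b := y), or_comm (a := x = w), d.fd_symm x y,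
      mul_comm (d.fd x w)]
  d_self x := by simp
  pos x y h := by
    rw [if_neg h]
    split_ifs with h'
    · simp
    · push Not at h'
      have h1 := d.fd_pos h
      have h2 := d.fd_pos h'.1
      have h3 := d.fd_pos h'.2
      exact ENNReal.ofReal_pos.mpr (by positivity)
  triangle x y z := by
    by_cases hxz : x = z
    · simp [hxz]
    by_cases hxy : x = y
    · simp [hxy]
    by_cases hyz : y = z
    · simp [hyz]
    rw [if_neg hxz, if_neg hxy, if_neg hyz]
    by_cases hy : y = w
    · simp [hy]
    by_cases hx : x = w
    · simp [hx]
    by_cases hz : z = w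
    · simp [hz]
    simp only [hx, hy, hz, or_self, if_false]
    have h1 := d.fd_pos hx
    have h2 := d.fd_pos hy
    have h3 := d.fd_pos hz
    have h4 := d.fd_pos hxy
    have h5 := d.fd_pos hyz
    rw [← ENNReal.ofReal_add (by positivity) (by positivity)]
    apply ENNReal.ofReal_le_ofReal
    have h6 : d.fd x y / (d.fd x w * d.fd y w) + d.fd y z / (d.fd y w * d.fd z w) =
        (d.fd x y * d.fd z w + d.fd x w * d.fd y z) / (d.fd x w * d.fd y w * d.fd z w) := by
      field_simp
    have h7 : d.fd x z / (d.fd x w * d.fd z w) =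
        d.fd x z * d.fd y w / (d.fd x w * d.fd y w * d.fd z w) := by
      field_simp
    rw [h6, h7]
    exact div_le_div_of_nonneg_right (hd x y z hx hy hz) (by positivity)
  d_eq_top_iff x y := by
    simp only [Option.some.injEq, eq_comm (a := w)]
    split_ifs with h h' <;> simp [*]

open Classical in
theorem fd_invert (d : ExtMetric X) (w : X) (hd) (x y : X) :
    (d.invert w hd).fd x y =
      (if x = w then 1 else (d.fd x w)⁻¹) * (if y = w then 1 else (d.fd y w)⁻¹) * d.fd x y := by
  by_cases hxy : x = y
  · simp [hxy, fd_self]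
  by_cases hx : x = w
  · subst hx
    have := (d.fd_pos hxy).ne'
    rw [d.fd_symm] at this
    have hy : y ≠ x := Ne.symm hxy
    rw [if_pos rfl, if_neg hy, fd_symm, fd_rem rfl hy, d.fd_symm x y]
    field_simp
  by_cases hy : y = w
  · subst hy
    have := (d.fd_pos hxy).ne'
    rw [if_pos rfl, if_neg hx, fd_rem rfl hx]
    field_simp
  have h1 := d.fd_pos hx
  have h2 := d.fd_pos hy
  have h4 := d.fd_pos hxy
  have h5 : 0 ≤ d.fd x y / (d.fd x w * d.fd y w) := by positivity
  rw [fd]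
  simp only [invert, hxy, hx, hy, or_self, if_false, ENNReal.ofReal_ne_top,
    ENNReal.toReal_ofReal h5]
  field_simp

end ExtMetric

section

variable {X : Type*} {S : MobiusStructure X}

theorem Admissible.map {f : X → X} (hf : Function.Injective f) {x y z u : X}
    (h : Admissible x y z u) : Admissible (f x) (f y) (f z) (f u) := by
  simpa [Admissible, hf.eq_iff] using h

theorem IsMobiusAuto.comp {f g : X → X} (hf : IsMobiusAuto S f) (hg : IsMobiusAuto S g) :
    IsMobiusAuto S (f ∘ g) :=
  ⟨hf.1.comp hg.1, fun d hd x y z u h =>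
    (hg.2 d hd x y z u h).symm.trans' (hf.2 d hd _ _ _ _ (h.map hg.1.1))⟩

theorem IsMobiusAuto.pullback_mem {f : X → X} (hf : IsMobiusAuto S f) {d : ExtMetric X}
    (hd : d ∈ S.M) : d.pullback (Equiv.ofBijective f hf.1) ∈ S.M :=
  S.maximal _ fun d' hd' x y z u h =>
    (S.compat d hd d' hd' x y z u h).trans' (hf.2 d hd x y z u h)

theorem IsMobiusAuto.continuous {f : X → X} (hf : IsMobiusAuto S f) :
    @Continuous X X (mobiusTop S) (mobiusTop S) f := by
  let _ := mobiusTop S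
  refine continuous_generateFrom_iff.mpr ?_
  rintro s ⟨d, hd, x, hx, r, hr0, hr, hs⟩
  obtain ⟨x, rfl⟩ := hf.1.2 x
  refine TopologicalSpace.isOpen_generateFrom_of_mem
    ⟨_, hf.pullback_mem hd, x, ?_, r, hr0, hr, ?_⟩
  · simp only [ExtMetric.pullback, ne_eq, Option.map_eq_some_iff, not_exists, not_and]
    rintro y hy hyx
    apply hx
    rw [hy, ← hyx]
    exact congrArg some ((Equiv.ofBijective f hf.1).apply_symm_apply y).symm
  · rcases hs with rfl | rfl
    · exact Or.inl rfl
    · exact Or.inr rfl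

theorem IsPtolemyStructure.exists_rem_eq (hS : IsPtolemyStructure S) (w : X) :
    ∃ d ∈ S.M, d.rem = some w := by
  classical
  obtain ⟨d, hd⟩ := S.nonempty
  refine ⟨d.invert w fun x y z hx hy hz => ?_, ?_, rfl⟩
  · by_cases hxyz : x = y ∧ y = z
    · obtain ⟨rfl, rfl⟩ := hxyz
      simp [ExtMetric.fd_self]
    · exact (hS d hd x y z w (by simp only [Admissible]; tauto)).2.1
  · refine S.maximal _ fun d' hd' x y z u h => (S.compat d hd d' hd' x y z u h).trans' ?_
    have hpos : ∀ x, 0 < (if x = w then 1 else (d.fd x w)⁻¹) := fun x => by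
      split_ifs with h
      · exact one_pos
      · exact inv_pos.mpr (d.fd_pos h)
    refine ⟨_, mul_pos (mul_pos (hpos x) (hpos y)) (mul_pos (hpos z) (hpos u)), ?_⟩
    simp only [crtVec, ExtMetric.fd_invert, Prod.smul_mk, smul_eq_mul, Prod.mk.injEq]
    refine ⟨?_, ?_, ?_⟩ <;> ring

/-- The Ptolemy equality, read off in a metric with infinitely remote point `ω'`. -/
theorem IsPtolemyCircle.fd_eq_add (hS : IsPtolemyStructure S) {σ : Set X}
    (hσ : IsPtolemyCircle S σ) {ω ω' p q : X} (hω : ω ∈ σ) (hω' : ω' ∈ σ) (hp : p ∈ σ)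
    (hq : q ∈ σ) (hne : ω ≠ ω') (hpω : p ≠ ω) (hpω' : p ≠ ω') (hqω : q ≠ ω) (hqω' : q ≠ ω')
    (hpq : p ≠ q) (hsep : SeparatesIn S σ ω q ω' p) {d : ExtMetric X} (hd : d ∈ S.M)
    (hrem : d.rem = some ω') : d.fd q ω = d.fd p q + d.fd p ω := by
  classical
  let _ := mobiusTop S
  obtain ⟨e, f, hc⟩ := exists_isLineChart hσ.1 hω
  obtain ⟨s, -, hs⟩ := hc.infinite.exists_notMem_finset {ω, ω', p, q}
  simp only [Finset.mem_insert, Finset.mem_singleton, not_or] at hs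
  obtain ⟨hs1, hs2, hs3, hs4⟩ := hs
  obtain ⟨d', hd', hrem'⟩ := hS.exists_rem_eq s
  have hpt := hσ.2 d' hd' ω hω ω' hω' q hq p hp hne hqω.symm hpω.symm hqω'.symm hpω'.symm
    hpq.symm hsep
  have hfin {a b : X} (ha : s ≠ a) (hb : s ≠ b) : d'.d a b = ENNReal.ofReal (d'.fd a b) :=
    ExtMetric.d_eq_ofReal_fd (ExtMetric.d_ne_top hrem' ha.symm hb.symm)
  have h1 := d'.fd_pos hne
  have h2 := d'.fd_pos hqω
  have h3 := d'.fd_pos hpω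
  have h4 := d'.fd_pos hqω'
  have h5 := d'.fd_pos hpω'
  have h6 := d'.fd_pos hpq
  rw [d'.fd_symm] at h2 h3 h4 h5 h6
  rw [hfin hs1 hs4, hfin hs2 hs3, hfin hs1 hs2, hfin hs4 hs3, hfin hs1 hs3, hfin hs2 hs4,
    ← ENNReal.ofReal_mul h2.le, ← ENNReal.ofReal_mul h1.le, ← ENNReal.ofReal_mul h3.le,
    ← ENNReal.ofReal_add (by positivity) (by positivity),
    ENNReal.ofReal_eq_ofReal_iff (by positivity) (by positivity)] at hpt
  have hadm : Admissible ω ω' q p := by simp only [Admissible]; tauto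
  obtain ⟨l, hl, h⟩ := S.compat d' hd' d hd ω ω' q p hadm
  simp only [crtVec, Prod.smul_mk, smul_eq_mul, Prod.mk.injEq] at h
  obtain ⟨ha, hb, hc⟩ := h
  rw [d.fd_symm ω' p, ExtMetric.fd_rem hrem hpω', mul_one, d.fd_symm] at hb
  rw [ExtMetric.fd_rem hrem hne, one_mul, d.fd_symm] at ha
  rw [d.fd_symm ω' q, ExtMetric.fd_rem hrem hqω', mul_one, d.fd_symm] at hc
  rw [ha, hb, hc, hpt]
  ring

/-- On an arc of a Ptolemy circle between `ω` and `ω'`, a point is determined by its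
distance to `ω` in a metric with infinitely remote point `ω'`. -/
theorem IsPtolemyCircle.eq_of_fd_eq (hS : IsPtolemyStructure S) {σ : Set X}
    (hσ : IsPtolemyCircle S σ) {ω ω' p q : X} (hne : ω ≠ ω') (hω : ω ∈ σ) (hω' : ω' ∈ σ)
    (hp : p ∈ σ \ {ω, ω'}) (hq : q ∈ mobiusCCIn S (σ \ {ω, ω'}) p) {d : ExtMetric X}
    (hd : d ∈ S.M) (hrem : d.rem = some ω') (heq : d.fd p ω = d.fd q ω) : p = q := by
  by_contra hpq
  let _ := mobiusTop S
  obtain ⟨e, f, hc⟩ := exists_isLineChart hσ.1 hω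
  have hq' : q ∈ σ \ {ω, ω'} := connectedComponentIn_subset _ _ hq
  have hw : ω' ∈ σ \ {ω} := ⟨hω', hne.symm⟩
  have hside := (hc.mem_connectedComponentIn_iff hw hp hq').mp hq
  have hep := hc.ne_of_mem hw hp
  have heq' := hc.ne_of_mem hw hq'
  obtain ⟨hpσ, hp2⟩ := hp
  obtain ⟨hqσ, hq2⟩ := hq'
  simp only [Set.mem_insert_iff, Set.mem_singleton_iff, not_or] at hp2 hq2
  have hepq : e p ≠ e q := fun h => hpq (hc.injOn ⟨hpσ, hp2.1⟩ ⟨hqσ, hq2.1⟩ h)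
  have hsep : SeparatesIn S σ ω q ω' p ∨ SeparatesIn S σ ω p ω' q := by
    have h1 := hc.mem_connectedComponentIn_iff (p := q) (u := ω') (v := p) ⟨hqσ, hq2.1⟩
      ⟨hω', by simp [hne.symm, Ne.symm hq2.2]⟩ ⟨hpσ, by simp [hp2.1, hpq]⟩
    have h2 := hc.mem_connectedComponentIn_iff (p := p) (u := ω') (v := q) ⟨hpσ, hp2.1⟩
      ⟨hω', by simp [hne.symm, Ne.symm hp2.2]⟩ ⟨hqσ, by simp [hq2.1, Ne.symm hpq]⟩
    change ¬ (p ∈ connectedComponentIn _ _) ∨ ¬ (q ∈ connectedComponentIn _ _)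
    rw [h1, h2]
    grind
  rcases hsep with h | h
  · have := hσ.fd_eq_add hS hω hω' hpσ hqσ hne hp2.1 hp2.2 hq2.1 hq2.2 hpq h hd hrem
    have := d.fd_pos hpq
    linarith
  · have := hσ.fd_eq_add hS hω hω' hqσ hpσ hne hq2.1 hq2.2 hp2.1 hp2.2 (Ne.symm hpq) h hd hrem
    have := d.fd_pos (Ne.symm hpq)
    linarith

/-- A metric sphere between `ω` and `ω'` meets every Ptolemy circle through these points. -/
theorem IsPtolemyCircle.exists_d_eq {σ : Set X} (hσ : IsPtolemyCircle S σ) {ω ω' : X}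
    (hne : ω ≠ ω') (hω : ω ∈ σ) (hω' : ω' ∈ σ) {d : ExtMetric X} (hd : d ∈ S.M)
    (hrem : d.rem = some ω') {r : ℝ≥0∞} (hr0 : 0 < r) (hr : r ≠ ⊤) :
    ∃ y ∈ σ, d.d y ω = r := by
  let _ := mobiusTop S
  by_contra! hno
  have hremω : d.rem ≠ some ω := by simp [hrem, hne.symm]
  have hU : IsOpen {y | d.d y ω < r} := TopologicalSpace.isOpen_generateFrom_of_mem
    ⟨d, hd, ω, hremω, r, hr0, hr, Or.inl rfl⟩
  have hV : IsOpen {y | r < d.d y ω} := TopologicalSpace.isOpen_generateFrom_of_mem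
    ⟨d, hd, ω, hremω, r, hr0, hr, Or.inr rfl⟩
  have htop : d.d ω' ω = ⊤ := (d.d_eq_top_iff _ _).mpr ⟨hne.symm, Or.inl hrem⟩
  obtain ⟨y, -, hy1, hy2⟩ := isPreconnected_of_homeomorph_circle hσ.1 _ _ hU hV
    (fun y hy => lt_or_gt_of_ne (hno y hy)) ⟨ω, hω, by simpa [d.d_self] using hr0⟩
    ⟨ω', hω', by simpa [htop] using hr.lt_top⟩
  exact lt_asymm (show d.d y ω < r from hy1) hy2

namespace IsSpaceInversion

variable {ω ω' : X} {Sp : Set X} {φ : X → X}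

theorem apply_right (hφ : IsSpaceInversion S ω ω' Sp φ) : φ ω' = ω := by
  rw [← hφ.2.2.2.1, hφ.2.1]

theorem mapsTo (hφ : IsSpaceInversion S ω ω' Sp φ) {σ : Set X} (hσ : IsPtolemyCircle S σ)
    (hω : ω ∈ σ) (hω' : ω' ∈ σ) : Set.MapsTo φ (σ \ {ω, ω'}) (σ \ {ω, ω'}) := by
  rintro x ⟨hx, hx'⟩
  simp only [Set.mem_insert_iff, Set.mem_singleton_iff, not_or] at hx'
  refine ⟨?_, ?_⟩
  · rw [← hφ.2.2.2.2.2 σ hσ hω hω']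
    exact ⟨x, hx, rfl⟩
  · rintro (h | h)
    · exact hx'.2 (hφ.1.1.1 (h.trans hφ.apply_right.symm))
    · exact hx'.1 (hφ.1.1.1 (Eq.trans h hφ.2.2.2.1.symm))

theorem fd_mul_fd_apply_eq (hφ : IsSpaceInversion S ω ω' Sp φ) (hne : ω ≠ ω')
    {d : ExtMetric X} (hd : d ∈ S.M) (hrem : d.rem = some ω') {x y : X} (hx : x ≠ ω)
    (hx' : x ≠ ω') (hy : y ≠ ω) (hy' : y ≠ ω') :
    d.fd x ω * d.fd (φ x) ω = d.fd y ω * d.fd (φ y) ω := by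
  have hadm : Admissible x y ω ω' := by simp only [Admissible]; tauto
  obtain ⟨l, hl, h⟩ := hφ.1.2 d hd x y ω ω' hadm
  have hφx : φ x ≠ ω' := fun h => hx (hφ.1.1.1 (h.trans hφ.2.2.2.1.symm))
  have hφy : φ y ≠ ω' := fun h => hy (hφ.1.1.1 (h.trans hφ.2.2.2.1.symm))
  simp only [crtVec, Prod.smul_mk, smul_eq_mul, Prod.mk.injEq, hφ.2.2.2.1, hφ.apply_right,
    ExtMetric.fd_rem hrem hx', ExtMetric.fd_rem hrem hy', ExtMetric.fd_rem hrem hφx,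
    ExtMetric.fd_rem hrem hφy, one_mul, mul_one] at h
  rw [h.2.1, h.2.2]
  ring

/-- The distances to `ω` of a point and of its image under a space inversion multiply to the
square of the radius of the metric sphere. -/
theorem fd_mul_fd_apply {d : ExtMetric X} {r : ℝ} (hr : 0 < r)
    (hφ : IsSpaceInversion S ω ω' {x | d.d x ω = ENNReal.ofReal r} φ) (hne : ω ≠ ω')
    {σ : Set X} (hσ : IsPtolemyCircle S σ) (hω : ω ∈ σ) (hω' : ω' ∈ σ)
    (hd : d ∈ S.M) (hrem : d.rem = some ω') {x : X} (hx : x ≠ ω) (hx' : x ≠ ω') :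
    d.fd x ω * d.fd (φ x) ω = r ^ 2 := by
  obtain ⟨y, -, hy⟩ := hσ.exists_d_eq hne hω hω' hd hrem (ENNReal.ofReal_pos.mpr hr)
    ENNReal.ofReal_ne_top
  have hφy : d.d (φ y) ω = ENNReal.ofReal r := by
    have : φ y ∈ {x | d.d x ω = ENNReal.ofReal r} := by
      rw [← hφ.2.2.2.2.1]
      exact ⟨y, hy, rfl⟩
    exact this
  have hfd {z : X} (hz : d.d z ω = ENNReal.ofReal r) : d.fd z ω = r := by
    simp [ExtMetric.fd, hz, hr.le]
  have hyω : y ≠ ω := by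
    rintro rfl
    rw [d.d_self] at hy
    exact (ENNReal.ofReal_pos.mpr hr).ne hy
  have hyω' : y ≠ ω' := by
    rintro rfl
    rw [(d.d_eq_top_iff _ _).mpr ⟨hne.symm, Or.inl hrem⟩] at hy
    exact ENNReal.ofReal_ne_top hy.symm
  rw [hφ.fd_mul_fd_apply_eq hne hd hrem hx hx' hyω hyω', hfd hy, hfd hφy, sq]

/-- The composition of two space inversions with respect to `ω`, `ω'` preserves the arcs between
`ω` and `ω'` of every Ptolemy circle through these points. -/
theorem comp_mem_mobiusCCIn {Sp' : Set X} {ψ : X → X} (hφ : IsSpaceInversion S ω ω' Sp φ)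
    (hψ : IsSpaceInversion S ω ω' Sp' ψ) (hne : ω ≠ ω') {σ : Set X}
    (hσ : IsPtolemyCircle S σ) (hω : ω ∈ σ) (hω' : ω' ∈ σ) {y : X} (hy : y ∈ σ \ {ω, ω'}) :
    ψ (φ y) ∈ mobiusCCIn S (σ \ {ω, ω'}) y := by
  let _ := mobiusTop S
  obtain ⟨e, f, hc⟩ := exists_isLineChart hσ.1 hω
  have hw : ω' ∈ σ \ {ω} := ⟨hω', hne.symm⟩
  have hm := hφ.mapsTo hσ hω hω'
  have hm' := hψ.mapsTo hσ hω hω'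
  have h1 := hc.notMem_connectedComponentIn_of_involutive hφ.1.continuous hφ.2.1 hφ.2.2.1 hm hy
  have h2 := hc.notMem_connectedComponentIn_of_involutive hψ.1.continuous hψ.2.1 hψ.2.2.1 hm'
    (hm hy)
  rw [hc.mem_connectedComponentIn_iff hw hy (hm hy)] at h1
  rw [hc.mem_connectedComponentIn_iff hw (hm hy) (hm' (hm hy))] at h2
  refine (hc.mem_connectedComponentIn_iff hw hy (hm' (hm hy))).mpr ?_
  tauto

end IsSpaceInversion

end

/-- Proposition 4.2 of the paper.  Any Ptolemy space with properties
(E) and (I) possesses the homothety property (H): for all distinct `ω, ω'`, every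
Ptolemy circle `σ` through `ω, ω'`, and any two points `x, x'` in the same connected
component of `σ∖{ω,ω'}`, there is a Möbius automorphism `γ` fixing `ω` and `ω'`,
mapping every Ptolemy circle through `ω, ω'` onto itself preserving each of its two
arcs between `ω` and `ω'`, and with `γ x = x'`. -/
theorem stmt_4 {X : Type*} (S : MobiusStructure X)
    (hpt : IsPtolemyStructure S) (hE : PropertyE S) (hI : PropertyI S) :
    PropertyH S := by
  intro ω ω' hne σ hσ hω hω' x x' hx hx'
  have hx'σ : x' ∈ σ \ {ω, ω'} := @connectedComponentIn_subset X (mobiusTop S) _ _ _ hx'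
  obtain ⟨d, hd, hrem⟩ := hpt.exists_rem_eq ω'
  have hxne := hx.2
  have hxne' := hx'σ.2
  simp only [Set.mem_insert_iff, Set.mem_singleton_iff, not_or] at hxne hxne'
  have ha := d.fd_pos hxne.1
  have hb := d.fd_pos hxne'.1
  have hinv (r : ℝ) (hr : 0 < r) :=
    (hI ω ω' hne {x | d.d x ω = ENNReal.ofReal r}
      ⟨d, hd, hrem, _, ENNReal.ofReal_pos.mpr hr, ENNReal.ofReal_ne_top, rfl⟩).exists
  have hr : 0 < √(d.fd x' ω / d.fd x ω) := by positivity
  obtain ⟨φ, hφ⟩ := hinv 1 one_pos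
  obtain ⟨ψ, hψ⟩ := hinv _ hr
  have hγx := hφ.comp_mem_mobiusCCIn hψ hne hσ hω hω' hx
  refine ⟨ψ ∘ φ, hψ.1.comp hφ.1, ?_, ?_, fun σ' hσ' h h' => ⟨?_, fun y hy => ?_⟩, ?_⟩
  · rw [Function.comp_apply, hφ.2.2.2.1, hψ.apply_right]
  · rw [Function.comp_apply, hφ.apply_right, hψ.2.2.2.1]
  · rw [Set.image_comp, hφ.2.2.2.2.2 σ' hσ' h h', hψ.2.2.2.2.2 σ' hσ' h h']
  · exact hφ.comp_mem_mobiusCCIn hψ hne hσ' h h' hy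
  · have hφx := hφ.mapsTo hσ hω hω' hx
    have hφxne := hφx.2
    simp only [Set.mem_insert_iff, Set.mem_singleton_iff, not_or] at hφxne
    have h1 := hφ.fd_mul_fd_apply one_pos hne hσ hω hω' hd hrem hxne.1 hxne.2
    have h2 := hψ.fd_mul_fd_apply hr hne hσ hω hω' hd hrem hφxne.1 hφxne.2
    rw [Real.sq_sqrt (by positivity)] at h2
    have hmem : x' ∈ mobiusCCIn S (σ \ {ω, ω'}) (ψ (φ x)) := by
      have := @connectedComponentIn_eq X (mobiusTop S) _ _ _ hγx
      rw [mobiusCCIn, ← this]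
      exact hx'
    refine hσ.eq_of_fd_eq hpt hne hω hω' (hψ.mapsTo hσ hω hω' hφx) hmem hd hrem ?_
    have h3 : d.fd (φ x) ω = (d.fd x ω)⁻¹ := by
      field_simp
      linarith
    rw [h3] at h2
    field_simp at h2
    exact h2

end Mobius
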